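/- arXiv:1908.11544 — 2 statements merged into one kernel-verified Lean document; each statement's English description precedes it below -/
import Mathlib

section
/- Let a : ℕ → ℝ satisfy a(1) = 0, a(2) = 1/3, and (n+1)·a(n) = 2·a(n-1) + (n-1)·(a(n-2) + 1) for all n ≥ 3, and let b : ℕ → ℝ satisfy b(1) = 0, b(2) = 0, and n(n+2)·b(n+1) = (2n+1)·b(n) + (n²−1)·b(n−1) + n² for all n ≥ 2. Then a(n) − b(n) tends to (1 − ln 2)/2 as n → ∞. -/
open Filter

/-- Casting the recursion of the harmonic numbers to `ℝ`. -/
lemma cast_harmonic_succ (n : ℕ) :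
    ((harmonic (n + 1) : ℚ) : ℝ) = (harmonic n : ℝ) + 1 / ((n : ℝ) + 1) := by
  rw [harmonic_succ]
  push_cast
  rw [one_div]

lemma cast_harmonic_two_mul_add_two (k : ℕ) :
    ((harmonic (2 * k + 2) : ℚ) : ℝ)
      = (harmonic (2 * k + 1) : ℝ) + 1 / (2 * (k : ℝ) + 2) := by
  rw [cast_harmonic_succ (2 * k + 1)]
  push_cast
  ring

lemma cast_harmonic_two_mul_add_three (k : ℕ) :
    ((harmonic (2 * k + 3) : ℚ) : ℝ)
      = (harmonic (2 * k + 1) : ℝ) + 1 / (2 * (k : ℝ) + 2) + 1 / (2 * (k : ℝ) + 3) := by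
  rw [cast_harmonic_succ (2 * k + 2), cast_harmonic_two_mul_add_two]
  push_cast
  ring

/-- Closed form of the average genus of the bouquet, in terms of harmonic numbers. -/
lemma bouquet_average_genus_eq
    (a : ℕ → ℝ) (ha1 : a 1 = 0) (ha2 : a 2 = 1/3)
    (harec : ∀ n : ℕ, 3 ≤ n →
      ((n : ℝ) + 1) * a n = 2 * a (n - 1) + ((n : ℝ) - 1) * (a (n - 2) + 1)) (k : ℕ) :
    a (2 * k + 1) = (k : ℝ) + 1 - harmonic (2 * k + 1) + harmonic k / 2 ∧
    a (2 * k + 2) = (k : ℝ) + 1 - harmonic (2 * k + 2) / 2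
      + (1 - harmonic (2 * k + 3) + harmonic (k + 1)) / 2 := by
  induction k with
  | zero => norm_num [ha1, ha2, harmonic, Finset.sum_range_succ]
  | succ k ih =>
    obtain ⟨hodd, heven⟩ := ih
    have hrec_odd := harec (2 * k + 3) (by omega)
    have hrec_even := harec (2 * k + 4) (by omega)
    simp only [show 2 * k + 3 - 1 = 2 * k + 2 by omega, show 2 * k + 3 - 2 = 2 * k + 1 by omega,
      show 2 * k + 4 - 1 = 2 * k + 3 by omega,
      show 2 * k + 4 - 2 = 2 * k + 2 by omega] at hrec_odd hrec_even
    have h4 := cast_harmonic_two_mul_add_two (k + 1)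
    have h5 := cast_harmonic_two_mul_add_three (k + 1)
    simp only [show 2 * (k + 1) + 1 = 2 * k + 3 by ring, show 2 * (k + 1) + 2 = 2 * k + 4 by ring,
      show 2 * (k + 1) + 3 = 2 * k + 5 by ring] at h4 h5 ⊢
    rw [cast_harmonic_two_mul_add_two, cast_harmonic_two_mul_add_three,
      cast_harmonic_succ k] at heven
    rw [heven, hodd] at hrec_odd
    have hvalue : a (2 * k + 3) = ((k + 1 : ℕ) : ℝ) + 1 - harmonic (2 * k + 3)
        + harmonic (k + 1) / 2 := by
      rw [cast_harmonic_two_mul_add_three, cast_harmonic_succ k]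
      push_cast at hrec_odd ⊢
      apply mul_left_cancel₀ (show (2 * (k : ℝ) + 3 + 1) ≠ 0 by positivity)
      rw [hrec_odd]
      field_simp
      ring
    refine ⟨hvalue, ?_⟩
    rw [hvalue, heven] at hrec_even
    rw [h5, h4, cast_harmonic_succ (k + 1)]
    rw [cast_harmonic_two_mul_add_three, cast_harmonic_succ k] at hrec_even ⊢
    push_cast at hrec_even ⊢
    apply mul_left_cancel₀ (show (2 * (k : ℝ) + 4 + 1) ≠ 0 by positivity)
    rw [hrec_even]
    field_simp
    ring

/-- Closed form of the average genus of the dipole, in terms of harmonic numbers. -/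
lemma dipole_average_genus_eq
    (b : ℕ → ℝ) (hb1 : b 1 = 0) (hb2 : b 2 = 0)
    (hbrec : ∀ n : ℕ, 2 ≤ n →
      (n : ℝ) * ((n : ℝ) + 2) * b (n + 1)
        = (2 * (n : ℝ) + 1) * b n + ((n : ℝ) ^ 2 - 1) * b (n - 1) + (n : ℝ) ^ 2) (k : ℕ) :
    b (2 * k + 1) = (2 * (k : ℝ) + 1) / 2 - harmonic (2 * k + 1) / 2
      - k / ((2 * (k : ℝ) + 1) * (2 * k + 2)) ∧
    b (2 * k + 2) = (k : ℝ) + 1 - harmonic (2 * k + 2) / 2 - 1 / (2 * (2 * (k : ℝ) + 2)) := by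
  induction k with
  | zero => norm_num [hb1, hb2, harmonic, Finset.sum_range_succ]
  | succ k ih =>
    obtain ⟨hodd, heven⟩ := ih
    have hrec_odd := hbrec (2 * k + 2) (by omega)
    have hrec_even := hbrec (2 * k + 3) (by omega)
    simp only [show 2 * k + 2 - 1 = 2 * k + 1 by omega, show 2 * k + 2 + 1 = 2 * k + 3 by omega,
      show 2 * k + 3 - 1 = 2 * k + 2 by omega,
      show 2 * k + 3 + 1 = 2 * k + 4 by omega] at hrec_odd hrec_even
    have h4 := cast_harmonic_two_mul_add_two (k + 1)
    simp only [show 2 * (k + 1) + 1 = 2 * k + 3 by ring,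
      show 2 * (k + 1) + 2 = 2 * k + 4 by ring] at h4 ⊢
    rw [cast_harmonic_two_mul_add_two] at heven
    rw [heven, hodd] at hrec_odd
    have hvalue : b (2 * k + 3) = (2 * ((k + 1 : ℕ) : ℝ) + 1) / 2 - harmonic (2 * k + 3) / 2
        - (k + 1 : ℕ) / ((2 * ((k + 1 : ℕ) : ℝ) + 1) * (2 * (k + 1 : ℕ) + 2)) := by
      rw [cast_harmonic_two_mul_add_three]
      push_cast at hrec_odd ⊢
      apply mul_left_cancel₀ (show (2 * (k : ℝ) + 2) * (2 * (k : ℝ) + 2 + 2) ≠ 0 by positivity)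
      rw [hrec_odd]
      field_simp
      ring
    refine ⟨hvalue, ?_⟩
    rw [hvalue, heven] at hrec_even
    rw [h4]
    rw [cast_harmonic_two_mul_add_three] at hrec_even ⊢
    push_cast at hrec_even ⊢
    apply mul_left_cancel₀ (show (2 * (k : ℝ) + 3) * (2 * (k : ℝ) + 3 + 2) ≠ 0 by positivity)
    rw [hrec_even]
    field_simp
    ring

lemma tendsto_harmonic_two_mul_add_one_sub_harmonic :
    Tendsto (fun k : ℕ => (harmonic (2 * k + 1) : ℝ) - harmonic k) atTop
      (nhds (Real.log 2)) := by
  have hdouble : Tendsto (fun k : ℕ => 2 * k) atTop atTop :=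
    tendsto_id.const_mul_atTop' (by norm_num)
  have hsub := ((Real.tendsto_harmonic_sub_log.comp hdouble).sub
    Real.tendsto_harmonic_sub_log).add_const (Real.log 2)
  have hinv := (tendsto_one_div_add_atTop_nhds_zero_nat (𝕜 := ℝ)).comp hdouble
  have hsum := hsub.add hinv
  rw [sub_self, zero_add, add_zero] at hsum
  refine hsum.congr' ?_
  filter_upwards [eventually_gt_atTop 0] with k hk
  have hk' : (k : ℝ) ≠ 0 := by positivity
  rw [cast_harmonic_succ]
  simp only [Function.comp_apply]
  push_cast
  rw [Real.log_mul two_ne_zero hk']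
  ring

theorem bouquet_dipole_average_genus_difference
    (a : ℕ → ℝ) (ha1 : a 1 = 0) (ha2 : a 2 = 1/3)
    (harec : ∀ n : ℕ, 3 ≤ n →
      ((n : ℝ) + 1) * a n = 2 * a (n - 1) + ((n : ℝ) - 1) * (a (n - 2) + 1))
    (b : ℕ → ℝ) (hb1 : b 1 = 0) (hb2 : b 2 = 0)
    (hbrec : ∀ n : ℕ, 2 ≤ n →
      (n : ℝ) * ((n : ℝ) + 2) * b (n + 1)
        = (2 * (n : ℝ) + 1) * b n + ((n : ℝ) ^ 2 - 1) * b (n - 1) + (n : ℝ) ^ 2) :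
    Tendsto (fun n : ℕ => a n - b n) atTop (nhds ((1 - Real.log 2) / 2)) := by
  set main : ℕ → ℝ := fun k => (1 - ((harmonic (2 * k + 1) : ℝ) - harmonic k)) / 2 with hmain
  have hmain_lim : Tendsto (fun n : ℕ => main (n / 2)) atTop
      (nhds ((1 - Real.log 2) / 2)) :=
    ((tendsto_harmonic_two_mul_add_one_sub_harmonic.const_sub 1).div_const 2).comp
      (Nat.tendsto_div_const_atTop two_ne_zero)
  have herror : Tendsto (fun n : ℕ => a n - b n - main (n / 2)) atTop (nhds 0) := by
    refine squeeze_zero_norm' ?_ (tendsto_one_div_atTop_nhds_zero_nat (𝕜 := ℝ))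
    filter_upwards [eventually_gt_atTop 0] with n hn
    obtain ⟨k, rfl | rfl⟩ : ∃ k, n = 2 * k + 1 ∨ n = 2 * k + 2 := ⟨(n - 1) / 2, by omega⟩
    · have heq : a (2 * k + 1) - b (2 * k + 1) - main ((2 * k + 1) / 2)
          = k / ((2 * (k : ℝ) + 1) * (2 * k + 2)) := by
        rw [(bouquet_average_genus_eq a ha1 ha2 harec k).1,
          (dipole_average_genus_eq b hb1 hb2 hbrec k).1,
          show (2 * k + 1) / 2 = k by omega]
        simp only [hmain]
        ring
      rw [heq, Real.norm_of_nonneg (by positivity)]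
      push_cast
      rw [div_le_div_iff₀ (by positivity) (by positivity)]
      nlinarith [(Nat.cast_nonneg k : (0 : ℝ) ≤ k)]
    · have heq : a (2 * k + 2) - b (2 * k + 2) - main ((2 * k + 2) / 2)
          = 1 / (2 * (2 * (k : ℝ) + 2)) := by
        rw [(bouquet_average_genus_eq a ha1 ha2 harec k).2,
          (dipole_average_genus_eq b hb1 hb2 hbrec k).2,
          show (2 * k + 2) / 2 = k + 1 by omega]
        simp only [hmain, show 2 * (k + 1) + 1 = 2 * k + 3 by ring]
        ring
      rw [heq, Real.norm_of_nonneg (by positivity)]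
      push_cast
      exact one_div_le_one_div_of_le (by positivity) (by linarith [(Nat.cast_nonneg k : (0 : ℝ) ≤ k)])
  simpa using herror.add hmain_lim
end

section
/- Let b : ℕ → ℝ satisfy b(1) = 0, b(2) = 0, and n(n+2)·b(n+1) = (2n+1)·b(n) + (n²−1)·b(n−1) + n² for all n ≥ 2. Then b(n)/⌊(n−1)/2⌋ tends to 1 as n → ∞. -/
open Filter

/-- If `n(n+2) b(n+1) = (2n+1) b(n) + (n²-1) b(n-1) + n²`, with `b 1 = b 2 = 0`, the increments
of `b` are `1/2 - 1/(2n)` up to an error at most `2/n`. -/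
lemma abs_dipole_increment_le
    (b : ℕ → ℝ) (hb1 : b 1 = 0) (hb2 : b 2 = 0)
    (hrec : ∀ n : ℕ, 2 ≤ n →
      (n : ℝ) * ((n : ℝ) + 2) * b (n + 1)
        = (2 * (n : ℝ) + 1) * b n + ((n : ℝ) ^ 2 - 1) * b (n - 1) + (n : ℝ) ^ 2) (k : ℕ) :
    |((k : ℝ) + 1) * (b (k + 2) - b (k + 1) - 1 / 2) + 1 / 2| ≤ 2 := by
  induction k with
  | zero => norm_num [hb1, hb2]
  | succ k ih =>
    have h := hrec (k + 2) (by omega)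
    rw [show k + 2 - 1 = k + 1 by omega] at h
    push_cast at h ⊢
    have hk : (0 : ℝ) ≤ k := k.cast_nonneg
    have key : ((k : ℝ) + 4) * (((k : ℝ) + 1 + 1) * (b (k + 1 + 2) - b (k + 1 + 1) - 1 / 2) + 1 / 2)
        = 2 - (k + 3) * (((k : ℝ) + 1) * (b (k + 2) - b (k + 1) - 1 / 2) + 1 / 2) := by
      rw [show k + 1 + 2 = k + 2 + 1 by ring, show k + 1 + 1 = k + 2 by ring]
      linear_combination h
    rw [abs_le] at ih ⊢
    constructor <;> nlinarith

lemma tendsto_dipole_increment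
    (b : ℕ → ℝ) (hb1 : b 1 = 0) (hb2 : b 2 = 0)
    (hrec : ∀ n : ℕ, 2 ≤ n →
      (n : ℝ) * ((n : ℝ) + 2) * b (n + 1)
        = (2 * (n : ℝ) + 1) * b n + ((n : ℝ) ^ 2 - 1) * b (n - 1) + (n : ℝ) ^ 2) :
    Tendsto (fun k : ℕ => b (k + 2) - b (k + 1)) atTop (nhds (1 / 2)) := by
  rw [tendsto_iff_norm_sub_tendsto_zero]
  have hlim : Tendsto (fun k : ℕ => 3 * (1 / ((k : ℝ) + 1))) atTop (nhds 0) := by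
    simpa using (tendsto_one_div_add_atTop_nhds_zero_nat (𝕜 := ℝ)).const_mul 3
  refine squeeze_zero (fun _ => norm_nonneg _) (fun k => ?_) hlim
  have h := abs_dipole_increment_le b hb1 hb2 hrec k
  have hk : (0 : ℝ) < (k : ℝ) + 1 := by positivity
  rw [Real.norm_eq_abs, mul_one_div, le_div_iff₀ hk, ← abs_of_pos hk, ← abs_mul,
    abs_le]
  rw [abs_le] at h
  constructor <;> linarith

lemma tendsto_natCast_half_div_self :
    Tendsto (fun n : ℕ => ((n / 2 : ℕ) : ℝ) / n) atTop (nhds (1 / 2)) := by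
  have h := (tendsto_nat_floor_mul_div_atTop (R := ℝ) (a := 1 / 2) (by norm_num)).comp
    (tendsto_natCast_atTop_atTop (R := ℝ))
  refine h.congr fun n => ?_
  have : ⌊(1 / 2 : ℝ) * n⌋₊ = n / 2 := by
    rw [one_div_mul_eq_div]
    exact_mod_cast Nat.floor_div_eq_div (K := ℝ) n 2
  simp only [Function.comp_apply, this]

theorem dipole_average_genus_vs_max_genus
    (b : ℕ → ℝ) (hb1 : b 1 = 0) (hb2 : b 2 = 0)
    (hrec : ∀ n : ℕ, 2 ≤ n →
      (n : ℝ) * ((n : ℝ) + 2) * b (n + 1)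
        = (2 * (n : ℝ) + 1) * b n + ((n : ℝ) ^ 2 - 1) * b (n - 1) + (n : ℝ) ^ 2) :
    Tendsto (fun n : ℕ => b n / (↑((n - 1) / 2) : ℝ)) atTop (nhds 1) := by
  rw [← tendsto_add_atTop_iff_nat 1]
  have hmean := (tendsto_dipole_increment b hb1 hb2 hrec).cesaro
  have hquot := hmean.div tendsto_natCast_half_div_self (by norm_num)
  rw [div_self (by norm_num)] at hquot
  refine hquot.congr' ?_
  filter_upwards [eventually_gt_atTop 0] with n hn
  have hn' : (n : ℝ) ≠ 0 := by exact_mod_cast hn.ne'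
  have hsum : ∑ k ∈ Finset.range n, (b (k + 2) - b (k + 1)) = b (n + 1) := by
    simpa [hb1] using Finset.sum_range_sub (fun k => b (k + 1)) n
  simp only [Pi.div_apply, hsum, Nat.add_sub_cancel]
  rw [inv_mul_eq_div, div_div_div_cancel_right₀ hn']
end
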